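/- Suppose ρ₁ ≠ ρ₂ and ρ₁⁻¹ = t₁ is an integer divisible by p. If μ_{M',D'} is a spectral measure with spectrum Λ (i.e., {e_λ : λ ∈ Λ} is an orthonormal basis of L²(μ_{M',D'})), then there exists λ ∈ Λ such that (Λ − λ) ∩ Z_k ≠ ∅ for each k ∈ {1, 2, 3}. -/

import Mathlib

open MeasureTheory Complex Matrix
open scoped ENNReal

noncomputable section

/-- The exponential function `e_λ(x) = e^{-2πi⟨λ,x⟩}` on `ℝ²`. -/
def expChar (lam x : Fin 2 → ℝ) : ℂ :=
  Complex.exp ((-2 * Real.pi * Complex.I) * ((lam 0 * x 0 + lam 1 * x 1 : ℝ) : ℂ))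

/-- The Fourier transform `μ̂(ξ) = ∫ e^{-2πi⟨ξ,x⟩} dμ(x)` of a measure on `ℝ²`. -/
def ftMeasure (μ : Measure (Fin 2 → ℝ)) (ξ : Fin 2 → ℝ) : ℂ :=
  ∫ x, expChar ξ x ∂μ

/-- The mask `m_D(ξ) = (1/p) Σ_{d∈D} e^{-2πi⟨ξ,d⟩}` of a digit system `D : Fin p → ℝ²`. -/
def mask {p : ℕ} (D : Fin p → (Fin 2 → ℝ)) (ξ : Fin 2 → ℝ) : ℂ :=
  (p : ℂ)⁻¹ * ∑ i : Fin p, expChar ξ (D i)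

/-- Integer digits, coerced to real vectors. -/
def digitR {p : ℕ} (D : Fin p → (Fin 2 → ℤ)) : Fin p → (Fin 2 → ℝ) :=
  fun i j => (D i j : ℝ)

/-- `μ` is the self-affine measure of the IFS `φ_d(x) = M⁻¹(x+d)`, `d ∈ D`:
a compactly supported Borel probability measure with `μ = (1/#D) Σ_d μ ∘ φ_d⁻¹`. -/
def IsSelfAffine {p : ℕ} (μ : Measure (Fin 2 → ℝ)) (M : Matrix (Fin 2) (Fin 2) ℝ)
    (D : Fin p → (Fin 2 → ℝ)) : Prop :=
  IsProbabilityMeasure μ ∧ (∃ K : Set (Fin 2 → ℝ), IsCompact K ∧ μ Kᶜ = 0) ∧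
  μ = (p : ℝ≥0∞)⁻¹ • ∑ i : Fin p, μ.map (fun x => M⁻¹.mulVec (x + D i))

/-- `Λ` is an orthogonal set of exponentials for `μ`. -/
def IsOrthoSet (μ : Measure (Fin 2 → ℝ)) (Λ : Set (Fin 2 → ℝ)) : Prop :=
  ∀ l ∈ Λ, ∀ l' ∈ Λ, l ≠ l' → ftMeasure μ (l - l') = 0

/-- `μ` is a spectral measure: some countable set of exponentials forms an
orthonormal (Hilbert) basis of `L²(μ)`. -/
def IsSpectral (μ : Measure (Fin 2 → ℝ)) : Prop :=
  ∃ Λ : Set (Fin 2 → ℝ), Λ.Countable ∧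
    ∃ b : HilbertBasis Λ ℂ (Lp ℂ 2 μ),
      ∀ lam : Λ, ⇑(b lam) =ᵐ[μ] expChar (lam : Fin 2 → ℝ)

/-- The standing assumption on the digit set: `a = (a₁,a₂)` has entries in `[1,p-1]`
and `Z(m_D) = ⋃_{j=1}^{p-1} (j·a/p + ℤ²)`. -/
def ZeroSetCond (p : ℕ) (D : Fin p → (Fin 2 → ℤ)) (a : Fin 2 → ℤ) : Prop :=
  (∀ i, 1 ≤ a i ∧ a i ≤ (p : ℤ) - 1) ∧
  ∀ ξ : Fin 2 → ℝ, mask (digitR D) ξ = 0 ↔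
    ∃ j : ℕ, 1 ≤ j ∧ j ≤ p - 1 ∧ ∃ k : Fin 2 → ℤ,
      ∀ i, ξ i = (j : ℝ) * (a i : ℝ) / p + (k i : ℝ)

/-- The upper-triangular expanding matrix `M = [[ρ₁⁻¹, c],[0, ρ₂⁻¹]]`. -/
def Mupper (ρ₁ ρ₂ c : ℝ) : Matrix (Fin 2) (Fin 2) ℝ := !![ρ₁⁻¹, c; 0, ρ₂⁻¹]

/-- The set `E_a = {h/l : gcd(h,l)=1, l·a₂ − h·a₁ ∈ ℤ∖pℤ} ∪ {0}`. -/
def Ea (p : ℕ) (a : Fin 2 → ℤ) : Set ℝ :=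
  {x | ∃ h l : ℤ, Int.gcd h l = 1 ∧ ¬ ((p : ℤ) ∣ (l * a 1 - h * a 0)) ∧
    x = (h : ℝ) / (l : ℝ)} ∪ {0}


theorem expChar_eq (l x : Fin 2 → ℝ) :
    expChar l x = Complex.exp (((-2 * Real.pi * (l 0 * x 0 + l 1 * x 1) : ℝ) : ℂ) * Complex.I) := by
  unfold expChar; congr 1; push_cast; ring

theorem norm_expChar (l x : Fin 2 → ℝ) : ‖expChar l x‖ = 1 := by
  rw [expChar_eq, Complex.norm_exp_ofReal_mul_I]

theorem expChar_zero (x : Fin 2 → ℝ) : expChar 0 x = 1 := by simp [expChar]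

theorem expChar_zero_right (x : Fin 2 → ℝ) : expChar x 0 = 1 := by simp [expChar]

theorem expChar_add_right (l x y : Fin 2 → ℝ) :
    expChar l (x + y) = expChar l x * expChar l y := by
  unfold expChar; rw [← Complex.exp_add]; congr 1; simp; ring

theorem expChar_sub (l l' x : Fin 2 → ℝ) :
    expChar (l - l') x = (starRingEnd ℂ) (expChar l' x) * expChar l x := by
  rw [expChar_eq, expChar_eq l, expChar_eq l', ← Complex.exp_conj, ← Complex.exp_add]
  congr 1
  rw [map_mul, Complex.conj_ofReal, Complex.conj_I]; simp; ring

theorem expChar_neg (l x : Fin 2 → ℝ) :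
    expChar (-l) x = (starRingEnd ℂ) (expChar l x) := by
  have := expChar_sub 0 l x
  simpa [expChar_zero] using this

theorem continuous_expChar (l : Fin 2 → ℝ) : Continuous (expChar l) := by
  unfold expChar; fun_prop

theorem continuous_expChar_left (x : Fin 2 → ℝ) : Continuous (fun l => expChar l x) := by
  unfold expChar; fun_prop

theorem norm_mask_le {p : ℕ} (hp : 0 < p) (D : Fin p → (Fin 2 → ℝ)) (ξ : Fin 2 → ℝ) :
    ‖mask D ξ‖ ≤ 1 := by
  unfold mask
  rw [norm_mul]
  have h : ‖∑ i : Fin p, expChar ξ (D i)‖ ≤ p := by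
    refine (norm_sum_le _ _).trans ?_
    simp [norm_expChar]
  have hp' : (0:ℝ) < p := by exact_mod_cast hp
  calc ‖(p:ℂ)⁻¹‖ * ‖∑ i : Fin p, expChar ξ (D i)‖ ≤ ‖(p:ℂ)⁻¹‖ * p := by gcongr
    _ = 1 := by simp; field_simp

theorem mask_neg {p : ℕ} (D : Fin p → (Fin 2 → ℝ)) (ξ : Fin 2 → ℝ) (h : mask D ξ = 0) :
    mask D (-ξ) = 0 := by
  have : mask D (-ξ) = (starRingEnd ℂ) (mask D ξ) := by
    simp [mask, expChar_neg]
  rw [this, h, map_zero]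

theorem integrable_expChar (ν : Measure (Fin 2 → ℝ)) [IsProbabilityMeasure ν] (ξ : Fin 2 → ℝ) :
    Integrable (expChar ξ) ν := by
  refine Integrable.of_bound (C := 1) (continuous_expChar ξ).aestronglyMeasurable ?_
  exact Filter.Eventually.of_forall fun x => (norm_expChar ξ x).le

theorem memLp_expChar (ν : Measure (Fin 2 → ℝ)) [IsProbabilityMeasure ν] (ξ : Fin 2 → ℝ) :
    MemLp (expChar ξ) 2 ν := by
  refine MemLp.of_bound (C := 1) (continuous_expChar ξ).aestronglyMeasurable ?_
  exact Filter.Eventually.of_forall fun x => (norm_expChar ξ x).le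

theorem ft_zero (ν : Measure (Fin 2 → ℝ)) [IsProbabilityMeasure ν] : ftMeasure ν 0 = 1 := by
  simp [ftMeasure, expChar_zero]

theorem continuous_ft (ν : Measure (Fin 2 → ℝ)) [IsProbabilityMeasure ν] :
    Continuous (ftMeasure ν) := by
  unfold ftMeasure
  refine continuous_of_dominated (bound := fun _ => 1) ?_ ?_ ?_ ?_
  · exact fun ξ => (continuous_expChar ξ).aestronglyMeasurable
  · exact fun ξ => Filter.Eventually.of_forall fun x => (norm_expChar ξ x).le
  · exact integrable_const _
  · exact Filter.Eventually.of_forall fun x => continuous_expChar_left x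

theorem inner_exp (ν : Measure (Fin 2 → ℝ)) [IsProbabilityMeasure ν] (f g : Lp ℂ 2 ν)
    (l l' : Fin 2 → ℝ) (hf : ⇑f =ᵐ[ν] expChar l) (hg : ⇑g =ᵐ[ν] expChar l') :
    inner ℂ f g = ftMeasure ν (l' - l) := by
  rw [L2.inner_def, ftMeasure]
  apply integral_congr_ae
  filter_upwards [hf, hg] with x h1 h2
  rw [h1, h2, expChar_sub]
  simp [mul_comm]

theorem bessel (ν : Measure (Fin 2 → ℝ)) [IsProbabilityMeasure ν] {ι : Type*} (A : Finset ι)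
    (v : ι → Fin 2 → ℝ)
    (hA : ∀ i ∈ A, ∀ j ∈ A, i ≠ j → ftMeasure ν (v i - v j) = 0) (ξ : Fin 2 → ℝ) :
    ∑ i ∈ A, ‖ftMeasure ν (ξ - v i)‖ ^ 2 ≤ 1 := by
  let e : (Fin 2 → ℝ) → Lp ℂ 2 ν := fun l => (memLp_expChar ν l).toLp _
  have he : ∀ l, ⇑(e l) =ᵐ[ν] expChar l := fun l => MemLp.coeFn_toLp _
  have hin : ∀ l l', inner ℂ (e l) (e l') = ftMeasure ν (l' - l) :=
    fun l l' => inner_exp ν _ _ l l' (he l) (he l')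
  have hno : ∀ l, ‖e l‖ = 1 := by
    intro l
    have h1 : inner ℂ (e l) (e l) = (1:ℂ) := by rw [hin, sub_self, ft_zero]
    rw [inner_self_eq_norm_sq_to_K] at h1
    have h2 : ‖e l‖ ^ 2 = 1 := Complex.ofReal_injective (by push_cast; exact h1)
    nlinarith [norm_nonneg (e l)]
  have horth : Orthonormal ℂ (fun i : A => e (v i)) := by
    refine ⟨fun i => hno _, fun i j hij => ?_⟩
    simp only [hin]
    exact hA _ j.2 _ i.2 (fun h => hij (Subtype.ext h.symm))
  have := horth.sum_inner_products_le (e ξ) (s := Finset.univ)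
  simp only [hin, hno] at this
  rw [← Finset.sum_coe_sort]
  simpa using this

theorem parseval (ν : Measure (Fin 2 → ℝ)) [IsProbabilityMeasure ν] (Λ : Set (Fin 2 → ℝ))
    (b : HilbertBasis Λ ℂ (Lp ℂ 2 ν))
    (hb : ∀ lam : Λ, ⇑(b lam) =ᵐ[ν] expChar (lam : Fin 2 → ℝ)) (ξ : Fin 2 → ℝ) :
    HasSum (fun l : Λ => ‖ftMeasure ν (ξ - l)‖ ^ 2) 1 := by
  let e : Lp ℂ 2 ν := (memLp_expChar ν ξ).toLp _
  have he : ⇑e =ᵐ[ν] expChar ξ := MemLp.coeFn_toLp _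
  have h := b.hasSum_inner_mul_inner e e
  have h1 : inner ℂ e e = (1:ℂ) := by rw [inner_exp ν _ _ ξ ξ he he, sub_self, ft_zero]
  rw [h1] at h
  have h2 : ∀ l : Λ, inner ℂ e (b l) * inner ℂ (b l) e
      = ((‖ftMeasure ν (ξ - l)‖ ^ 2 : ℝ) : ℂ) := by
    intro l
    rw [← inner_conj_symm, inner_exp ν _ _ l ξ (hb l) he, Complex.conj_mul']
    push_cast; rfl
  simp only [h2] at h
  have h' : HasSum (fun l : Λ => ((‖ftMeasure ν (ξ - l)‖ ^ 2 : ℝ) : ℂ)) ((1 : ℝ) : ℂ) := by simpa using h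
  exact Complex.hasSum_ofReal.1 h'

theorem avg_isProb {p : ℕ} (hp : 0 < p) (μ : Measure (Fin 2 → ℝ)) [IsProbabilityMeasure μ]
    (f : Fin p → (Fin 2 → ℝ) → (Fin 2 → ℝ)) (hf : ∀ i, Measurable (f i)) :
    IsProbabilityMeasure ((p : ℝ≥0∞)⁻¹ • ∑ i : Fin p, μ.map (f i)) := by
  constructor
  have : ∀ i, (μ.map (f i)) Set.univ = 1 := fun i => by
    rw [Measure.map_apply (hf i) MeasurableSet.univ]; simp
  simp [this]
  exact ENNReal.inv_mul_cancel (by exact_mod_cast hp.ne') (by simp)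

theorem avg_ft {p : ℕ} (μ : Measure (Fin 2 → ℝ)) [IsProbabilityMeasure μ]
    (f : Fin p → (Fin 2 → ℝ) → (Fin 2 → ℝ)) (hf : ∀ i, Measurable (f i)) (ξ : Fin 2 → ℝ) :
    ftMeasure ((p : ℝ≥0∞)⁻¹ • ∑ i : Fin p, μ.map (f i)) ξ
      = (p : ℂ)⁻¹ * ∑ i : Fin p, ∫ x, expChar ξ (f i x) ∂μ := by
  unfold ftMeasure
  rw [integral_smul_measure, integral_finsetSum_measure]
  · simp only [ENNReal.toReal_inv, ENNReal.toReal_natCast, Complex.real_smul]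
    push_cast
    congr 1
    refine Finset.sum_congr rfl fun i _ => ?_
    rw [integral_map (hf i).aemeasurable (continuous_expChar ξ).aestronglyMeasurable]
  · intro i _
    have : IsProbabilityMeasure (μ.map (f i)) := Measure.isProbabilityMeasure_map (hf i).aemeasurable
    exact integrable_expChar _ _

/-- diagonal scaling -/
def scl (r₁ r₂ : ℝ) (k : ℕ) (ξ : Fin 2 → ℝ) : Fin 2 → ℝ := ![r₁ ^ k * ξ 0, r₂ ^ k * ξ 1]

theorem continuous_scl (r₁ r₂ : ℝ) (k : ℕ) : Continuous (scl r₁ r₂ k) := by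
  unfold scl
  refine continuous_pi fun i => ?_
  fin_cases i <;> simp <;> fun_prop

theorem expChar_scl (r₁ r₂ : ℝ) (k : ℕ) (l x : Fin 2 → ℝ) :
    expChar l (scl r₁ r₂ k x) = expChar (scl r₁ r₂ k l) x := by
  simp only [expChar, scl]; congr 2; simp; ring

theorem scl_scl (r₁ r₂ : ℝ) (k m : ℕ) (x : Fin 2 → ℝ) :
    scl r₁ r₂ k (scl r₁ r₂ m x) = scl r₁ r₂ (k + m) x := by
  ext i; fin_cases i <;> simp [scl, pow_add, mul_assoc]

theorem scl_add (r₁ r₂ : ℝ) (k : ℕ) (x y : Fin 2 → ℝ) :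
    scl r₁ r₂ k (x + y) = scl r₁ r₂ k x + scl r₁ r₂ k y := by
  ext i; fin_cases i <;> simp [scl, mul_add]

theorem scl_neg (r₁ r₂ : ℝ) (k : ℕ) (x : Fin 2 → ℝ) :
    scl r₁ r₂ k (-x) = - scl r₁ r₂ k x := by
  ext i; fin_cases i <;> simp [scl]

theorem scl_zero_vec (r₁ r₂ : ℝ) (k : ℕ) : scl r₁ r₂ k 0 = 0 := by
  ext i; fin_cases i <;> simp [scl]

theorem ft_map_scl (μ : Measure (Fin 2 → ℝ)) (r₁ r₂ : ℝ) (k : ℕ) (ξ : Fin 2 → ℝ) :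
    ftMeasure (μ.map (scl r₁ r₂ k)) ξ = ftMeasure μ (scl r₁ r₂ k ξ) := by
  unfold ftMeasure
  rw [integral_map (continuous_scl r₁ r₂ k).measurable.aemeasurable
    (continuous_expChar ξ).aestronglyMeasurable]
  simp only [expChar_scl]

theorem avg_ft_affine {p : ℕ} (μ : Measure (Fin 2 → ℝ)) [IsProbabilityMeasure μ]
    (r₁ r₂ : ℝ) (k m : ℕ) (D : Fin p → (Fin 2 → ℝ)) (ξ : Fin 2 → ℝ) :
    ftMeasure ((p : ℝ≥0∞)⁻¹ • ∑ i : Fin p,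
      μ.map (fun x => scl r₁ r₂ k x + scl r₁ r₂ m (D i))) ξ
      = mask D (scl r₁ r₂ m ξ) * ftMeasure μ (scl r₁ r₂ k ξ) := by
  rw [avg_ft μ (fun i x => scl r₁ r₂ k x + scl r₁ r₂ m (D i)) (fun i => ((continuous_scl r₁ r₂ k).add continuous_const).measurable)]
  simp only [expChar_add_right, expChar_scl, integral_mul_const]
  rw [mask, ← Finset.mul_sum, ftMeasure]
  ring

/-- Fourier refinement equation. -/
theorem selfaffine_ft {p : ℕ} (μ : Measure (Fin 2 → ℝ)) (r₁ r₂ : ℝ)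
    (h1 : r₁ ≠ 0) (h2 : r₂ ≠ 0)
    (D : Fin p → (Fin 2 → ℝ)) (h : IsSelfAffine μ !![r₁⁻¹, 0; 0, r₂⁻¹] D) (ξ : Fin 2 → ℝ) :
    ftMeasure μ ξ = mask D (scl r₁ r₂ 1 ξ) * ftMeasure μ (scl r₁ r₂ 1 ξ) := by
  obtain ⟨hP, -, hμ⟩ := h
  have hinv : (!![r₁⁻¹, 0; 0, r₂⁻¹] : Matrix (Fin 2) (Fin 2) ℝ)⁻¹ = !![r₁, 0; 0, r₂] := by
    apply Matrix.inv_eq_right_inv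
    ext i j; fin_cases i <;> fin_cases j <;> simp [h1, h2]
  have hf : ∀ i, (fun x : Fin 2 → ℝ => (!![r₁⁻¹, 0; 0, r₂⁻¹] : Matrix (Fin 2) (Fin 2) ℝ)⁻¹.mulVec
      (x + D i)) = fun x => scl r₁ r₂ 1 x + scl r₁ r₂ 1 (D i) := by
    intro i; funext x; rw [hinv]
    ext j; fin_cases j <;> simp [scl, Matrix.mulVec, dotProduct, Fin.sum_univ_two, mul_add]
  simp only [hf] at hμ
  conv_lhs => rw [hμ]
  rw [avg_ft_affine]

theorem ft_zero_of_mask {p : ℕ} (μ : Measure (Fin 2 → ℝ)) (r₁ r₂ : ℝ) (D : Fin p → (Fin 2 → ℝ))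
    (h : ∀ ξ, ftMeasure μ ξ = mask D (scl r₁ r₂ 1 ξ) * ftMeasure μ (scl r₁ r₂ 1 ξ))
    (k : ℕ) : ∀ (ξ : Fin 2 → ℝ), mask D (scl r₁ r₂ (k+1) ξ) = 0 → ftMeasure μ ξ = 0 := by
  induction k with
  | zero => intro ξ hk; rw [h, hk, zero_mul]
  | succ k ih =>
    intro ξ hk
    rw [h, ih, mul_zero]
    rw [scl_scl]; exact hk

theorem mask_of_ft_zero {p : ℕ} (μ : Measure (Fin 2 → ℝ)) [IsProbabilityMeasure μ]
    (r₁ r₂ : ℝ) (h1 : 0 < r₁) (h1' : r₁ < 1) (h2 : 0 < r₂) (h2' : r₂ < 1)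
    (D : Fin p → (Fin 2 → ℝ))
    (h : ∀ ξ, ftMeasure μ ξ = mask D (scl r₁ r₂ 1 ξ) * ftMeasure μ (scl r₁ r₂ 1 ξ))
    (ξ : Fin 2 → ℝ) (h0 : ftMeasure μ ξ = 0) : ∃ k, 1 ≤ k ∧ mask D (scl r₁ r₂ k ξ) = 0 := by
  by_contra! hc
  have key : ∀ n, ftMeasure μ (scl r₁ r₂ n ξ) = 0 := by
    intro n
    induction n with
    | zero => 
      have : scl r₁ r₂ 0 ξ = ξ := by ext i; fin_cases i <;> simp [scl]
      rw [this, h0]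
    | succ n ih =>
      rw [h, scl_scl, add_comm 1 n] at ih
      exact (mul_eq_zero.1 ih).resolve_left (hc _ (by omega))
  have ht : Filter.Tendsto (fun n => scl r₁ r₂ n ξ) Filter.atTop (nhds 0) := by
    rw [tendsto_pi_nhds]
    intro i
    fin_cases i
    · simpa [scl] using (tendsto_pow_atTop_nhds_zero_of_lt_one h1.le h1').mul_const (ξ 0)
    · simpa [scl] using (tendsto_pow_atTop_nhds_zero_of_lt_one h2.le h2').mul_const (ξ 1)
  have h3 := ((continuous_ft μ).tendsto 0).comp ht
  rw [ft_zero] at h3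
  have h4 : (ftMeasure μ ∘ fun n => scl r₁ r₂ n ξ) = fun _ => 0 := by funext n; exact key n
  rw [h4] at h3
  exact zero_ne_one (tendsto_nhds_unique tendsto_const_nhds h3)

theorem mask_lt {p : ℕ} (hp : 0 < p) (D : Fin p → (Fin 2 → ℝ)) (i₀ i₁ : Fin p) (hi : i₁ ≠ i₀)
    (h0 : D i₀ = 0) (h1 : D i₁ = ![1, 0]) (ξ : Fin 2 → ℝ) (hu : 0 < ξ 0) (hu1 : ξ 0 < 1) :
    ‖mask D ξ‖ < 1 := by
  have hp' : (0:ℝ) < p := by exact_mod_cast hp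
  have hlt : ‖∑ i : Fin p, expChar ξ (D i)‖ < p := by
    have hm : i₁ ∈ Finset.univ.erase i₀ := by simp [hi]
    rw [← Finset.add_sum_erase _ _ (Finset.mem_univ i₀), ← Finset.add_sum_erase _ _ hm, ← add_assoc]
    have ha : ‖∑ x ∈ (Finset.univ.erase i₀).erase i₁, expChar ξ (D x)‖ ≤ (p:ℝ) - 2 := by
      refine (norm_sum_le _ _).trans ?_
      have hc := Finset.card_erase_add_one hm
      have hc2 := Finset.card_erase_add_one (Finset.mem_univ i₀)
      simp only [Finset.card_univ, Fintype.card_fin] at hc2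
      simp only [norm_expChar, Finset.sum_const, nsmul_eq_mul, mul_one]
      have : ((((Finset.univ.erase i₀).erase i₁).card : ℝ)) + 2 = p := by
        have h3 : ((Finset.univ.erase i₀).erase i₁).card + 2 = p := by omega
        exact_mod_cast h3
      linarith
    have hb : ‖expChar ξ (D i₀) + expChar ξ (D i₁)‖ < 2 := by
      rw [h0, h1, expChar_zero_right, expChar_eq]
      simp only [Matrix.cons_val_zero, Matrix.cons_val_one, mul_one, mul_zero, add_zero]
      set θ := -2 * Real.pi * ξ 0 with hθ
      have hcos : Real.cos θ < 1 := by
        refine lt_of_le_of_ne (Real.cos_le_one _) fun h => ?_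
        have := (Real.cos_eq_one_iff_of_lt_of_lt (x := θ) (by nlinarith [Real.pi_pos])
          (by nlinarith [Real.pi_pos])).1 h
        nlinarith [Real.pi_pos, mul_pos Real.pi_pos hu]
      have hsq : ‖1 + Complex.exp (θ * Complex.I)‖ ^ 2 = 2 + 2 * Real.cos θ := by
        rw [Complex.sq_norm, Complex.normSq_apply]
        simp only [Complex.add_re, Complex.add_im, Complex.one_re, Complex.one_im,
          Complex.exp_ofReal_mul_I_re, Complex.exp_ofReal_mul_I_im]
        nlinarith [Real.sin_sq_add_cos_sq θ]
      nlinarith [norm_nonneg (1 + Complex.exp (θ * Complex.I))]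
    linarith [norm_add_le (expChar ξ (D i₀) + expChar ξ (D i₁))
      (∑ x ∈ (Finset.univ.erase i₀).erase i₁, expChar ξ (D x))]
  unfold mask
  rw [norm_mul]
  calc ‖(p:ℂ)⁻¹‖ * ‖∑ i : Fin p, expChar ξ (D i)‖ < ‖(p:ℂ)⁻¹‖ * p := by
        gcongr; simpa using hp
    _ = 1 := by simp; field_simp

theorem final_contra {p : ℕ} (hp : 0 < p) (μ : Measure (Fin 2 → ℝ)) [IsProbabilityMeasure μ]
    (r₁ r₂ : ℝ) (hr1 : 0 < r₁) (hr1' : r₁ < 1)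
    (D : Fin p → (Fin 2 → ℝ)) (i₀ i₁ : Fin p) (hi : i₁ ≠ i₀)
    (h0 : D i₀ = 0) (h1 : D i₁ = ![1, 0]) (Λ : Set (Fin 2 → ℝ))
    (hpars : ∀ ξ, HasSum (fun l : Λ => ‖ftMeasure μ (ξ - l)‖ ^ 2) 1) (l₁ : Λ) (k : ℕ)
    (g : (Fin 2 → ℝ) → Λ → ℝ)
    (hle : ∀ ξ (l : Λ), ‖ftMeasure μ (ξ - l)‖ ^ 2 ≤ g ξ l)
    (hsum : ∀ ξ (B : Finset Λ), ∑ l ∈ B, g ξ l ≤ 1)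
    (hk : ∀ ξ, ‖ftMeasure μ (ξ - l₁)‖ ^ 2 = ‖mask D (scl r₁ r₂ k (ξ - l₁))‖ ^ 2 * g ξ l₁) :
    False := by
  have hge : ∀ ξ, g ξ l₁ ≤ ‖ftMeasure μ (ξ - l₁)‖ ^ 2 := by
    intro ξ
    by_contra! hlt
    have hnn : ∀ l, 0 ≤ g ξ l := fun l => (sq_nonneg _).trans (hle ξ l)
    have hs : Summable (g ξ) := summable_of_sum_le hnn (hsum ξ)
    have h2 := Summable.tsum_lt_tsum (hle ξ) hlt (hpars ξ).summable hs
    rw [(hpars ξ).tsum_eq] at h2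
    exact absurd (hs.tsum_le_of_sum_le (hsum ξ)) (not_le.2 h2)
  have hc : Continuous (fun s : ℝ => ftMeasure μ ![s, 0]) := by
    refine (continuous_ft μ).comp (continuous_pi fun i => ?_)
    fin_cases i <;> simp <;> fun_prop
  have hz : ftMeasure μ ![(0:ℝ), 0] ≠ 0 := by
    have : (![(0:ℝ), 0] : Fin 2 → ℝ) = 0 := by ext i; fin_cases i <;> rfl
    rw [this, ft_zero]; exact one_ne_zero
  have hev : ∀ᶠ s in nhds (0:ℝ), ftMeasure μ ![s, 0] ≠ 0 :=
    hc.continuousAt.eventually_ne hz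
  obtain ⟨δ, hδ, hball⟩ := Metric.eventually_nhds_iff.1 hev
  set s := min (δ/2) (1/2) with hs
  have hs0 : 0 < s := by positivity
  have hs1 : s < 1 := lt_of_le_of_lt (min_le_right _ _) (by norm_num)
  have hsδ : s < δ := lt_of_le_of_lt (min_le_left _ _) (by linarith)
  have hne := hball (y := s) (by simp [abs_of_pos hs0, hsδ])
  have e1 := hge (l₁ + ![s, 0])
  have e2 := hk (l₁ + ![s, 0])
  rw [add_sub_cancel_left] at e1 e2
  have hpos : 0 < ‖ftMeasure μ ![s, 0]‖ ^ 2 := by positivity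
  have hrk : r₁ ^ k ≤ 1 := pow_le_one₀ hr1.le hr1'.le
  have hrk0 : 0 < r₁ ^ k := pow_pos hr1 k
  have hm := mask_lt hp D i₀ i₁ hi h0 h1 (scl r₁ r₂ k ![s, 0]) (by simp [scl]; positivity)
    (by simp [scl]; nlinarith)
  have hm0 := norm_nonneg (mask D (scl r₁ r₂ k ![s, 0]))
  have hm2 : ‖mask D (scl r₁ r₂ k ![s, 0])‖ ^ 2 < 1 := by nlinarith
  have hg : 0 < g (l₁ + ![s, 0]) l₁ := by
    have := hle (l₁ + ![s, 0]) l₁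
    rw [add_sub_cancel_left] at this
    linarith
  nlinarith

/-- Existence of the measure with levels `1` and `k` removed. -/
theorem exists_removed {p : ℕ} (hp : 0 < p) (μ : Measure (Fin 2 → ℝ)) [IsProbabilityMeasure μ]
    (r₁ r₂ : ℝ) (D : Fin p → (Fin 2 → ℝ))
    (h : ∀ ξ, ftMeasure μ ξ = mask D (scl r₁ r₂ 1 ξ) * ftMeasure μ (scl r₁ r₂ 1 ξ))
    (k : ℕ) (hk : k = 2 ∨ k = 3) :
    ∃ ν : Measure (Fin 2 → ℝ), IsProbabilityMeasure ν ∧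
      (∀ ξ, ftMeasure μ ξ = mask D (scl r₁ r₂ 1 ξ) * mask D (scl r₁ r₂ k ξ) * ftMeasure ν ξ) ∧
      (∀ ξ l, 1 ≤ l → l ≠ 1 → l ≠ k → mask D (scl r₁ r₂ l ξ) = 0 → ftMeasure ν ξ = 0) := by
  rcases hk with rfl | rfl
  · refine ⟨μ.map (scl r₁ r₂ 2),
      Measure.isProbabilityMeasure_map (continuous_scl r₁ r₂ 2).measurable.aemeasurable, ?_, ?_⟩
    · intro ξ
      rw [ft_map_scl, h, h (scl r₁ r₂ 1 ξ), scl_scl]; ring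
    · intro ξ l h1 h2 h3 hm
      obtain ⟨m, rfl⟩ : ∃ m, l = m + 1 + 2 := ⟨l - 3, by omega⟩
      rw [ft_map_scl]
      exact ft_zero_of_mask μ r₁ r₂ D h m _ (by rw [scl_scl]; exact hm)
  · refine ⟨_, avg_isProb hp μ (fun i x => scl r₁ r₂ 3 x + scl r₁ r₂ 2 (D i))
      (fun i => ((continuous_scl r₁ r₂ 3).add continuous_const).measurable), ?_, ?_⟩
    · intro ξ
      rw [avg_ft_affine, h, h (scl r₁ r₂ 1 ξ), scl_scl, h (scl r₁ r₂ (1+1) ξ), scl_scl]; ring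
    · intro ξ l h1 h2 h3 hm
      rw [avg_ft_affine]
      by_cases hl : l = 2
      · subst hl; rw [hm, zero_mul]
      obtain ⟨m, rfl⟩ : ∃ m, l = m + 1 + 3 := ⟨l - 4, by omega⟩
      rw [ft_zero_of_mask μ r₁ r₂ D h m _ (by rw [scl_scl]; exact hm), mul_zero]

/-- p-adic level of the first coordinate -/
def Lev (p : ℕ) (t d : ℤ) (k : ℕ) (x : ℝ) : Prop :=
  ∃ n : ℤ, ¬ (p : ℤ) ∣ n ∧ x * p = (t : ℝ) ^ k * d * n

theorem lev_unique_aux (p : ℕ) (t d : ℤ) (ht : t ≠ 0) (hd : d ≠ 0) (hpt : (p:ℤ) ∣ t) (k m : ℕ)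
    (x : ℝ) (h1 : Lev p t d k x) (h2 : Lev p t d m x) : ¬ k < m := by
  intro hlt
  obtain ⟨n, hn, e1⟩ := h1
  obtain ⟨n', hn', e2⟩ := h2
  rw [e1] at e2
  have e3 : t ^ k * d * n = t ^ m * d * n' := by exact_mod_cast e2
  obtain ⟨q, rfl⟩ : ∃ q, m = k + (q + 1) := ⟨m - k - 1, by omega⟩
  have e4 : (t ^ k * d) * n = (t ^ k * d) * (t * (t ^ q * n')) := by rw [e3]; ring
  have e5 := mul_left_cancel₀ (mul_ne_zero (pow_ne_zero _ ht) hd) e4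
  exact hn (e5 ▸ Dvd.dvd.mul_right hpt _)

theorem lev_unique (p : ℕ) (t d : ℤ) (ht : t ≠ 0) (hd : d ≠ 0) (hpt : (p:ℤ) ∣ t) (k m : ℕ)
    (x : ℝ) (h1 : Lev p t d k x) (h2 : Lev p t d m x) : k = m := by
  have a1 := lev_unique_aux p t d ht hd hpt k m x h1 h2
  have a2 := lev_unique_aux p t d ht hd hpt m k x h2 h1
  omega

theorem lev_add (p : ℕ) (t d : ℤ) (hpt : (p:ℤ) ∣ t) (k m : ℕ) (hkm : k < m)
    (x y : ℝ) (h1 : Lev p t d k x) (h2 : Lev p t d m y) : Lev p t d k (x + y) := by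
  obtain ⟨n, hn, e1⟩ := h1
  obtain ⟨n', hn', e2⟩ := h2
  obtain ⟨q, rfl⟩ : ∃ q, m = k + (q + 1) := ⟨m - k - 1, by omega⟩
  refine ⟨n + t * (t ^ q * n'), ?_, ?_⟩
  · intro h; exact hn ((Int.dvd_add_left (Dvd.dvd.mul_right hpt _)).1 h)
  · rw [add_mul, e1, e2]; push_cast; ring

theorem lev_ne_zero (p : ℕ) (t d : ℤ) (ht : t ≠ 0) (hd : d ≠ 0) (k : ℕ) : ¬ Lev p t d k 0 := by
  rintro ⟨n, hn, e⟩
  rw [zero_mul] at e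
  have : t ^ k * d * n = 0 := by exact_mod_cast e.symm
  have h2 : n = 0 := by simpa [ht, hd] using this
  exact hn (h2 ▸ dvd_zero _)

theorem not_dvd_lin (p : ℕ) (hp : p.Prime) (a : ℤ) (ha : 1 ≤ a ∧ a ≤ (p:ℤ) - 1) (j : ℤ)
    (hj : ¬ (p:ℤ) ∣ j) (n : ℤ) : ¬ (p:ℤ) ∣ j * a + p * n := by
  intro h
  have h2 : (p:ℤ) ∣ j * a := (Int.dvd_add_left (Dvd.intro _ rfl)).1 h
  rcases (Nat.prime_iff_prime_int.1 hp).dvd_or_dvd h2 with h3 | h3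
  · exact hj h3
  · have := Int.le_of_dvd (by omega) h3; omega

theorem mask_bessel (p : ℕ) (hp : p.Prime) (D : Fin p → (Fin 2 → ℤ)) (a : Fin 2 → ℤ)
    (hZ : ZeroSetCond p D a) (ζ : Fin 2 → ℝ) :
    ∑ j ∈ Finset.range p, ‖mask (digitR D) (ζ - fun i => (j:ℝ) * a i / p)‖ ^ 2 ≤ 1 := by
  have hpr := avg_isProb hp.pos (Measure.dirac (0 : Fin 2 → ℝ))
    (fun i _ => digitR D i) (fun i => measurable_const)
  have hft : ∀ ξ, ftMeasure ((p : ℝ≥0∞)⁻¹ • ∑ i : Fin p,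
      (Measure.dirac (0 : Fin 2 → ℝ)).map (fun _ => digitR D i)) ξ = mask (digitR D) ξ := by
    intro ξ
    rw [avg_ft _ (fun i _ => digitR D i) (fun i => measurable_const), mask]
    simp
  have hlt : ∀ i j : ℕ, i < j → j < p → mask (digitR D)
      ((fun s => (j:ℝ) * a s / p) - fun s => (i:ℝ) * a s / p) = 0 := by
    intro i j hij hj
    rw [hZ.2]
    refine ⟨j - i, by omega, by omega, 0, fun s => ?_⟩
    rw [Nat.cast_sub hij.le]; simp; ring
  have := bessel (ν := (p : ℝ≥0∞)⁻¹ • ∑ i : Fin p,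
      (Measure.dirac (0 : Fin 2 → ℝ)).map (fun _ => digitR D i)) (Finset.range p)
      (fun (j : ℕ) (i : Fin 2) => (j:ℝ) * (a i : ℝ) / p) ?_ ζ
  · simpa only [hft] using this
  · intro i hi j hj hij
    rw [hft]
    simp only [Finset.mem_range] at hi hj
    rcases lt_or_gt_of_ne hij with h | h
    · have := mask_neg _ _ (hlt i j h hj)
      rwa [neg_sub] at this
    · exact hlt j i h hi

theorem mask_periodic {p : ℕ} (D : Fin p → (Fin 2 → ℤ)) (ζ : Fin 2 → ℝ) (n : Fin 2 → ℤ) :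
    mask (digitR D) (ζ - fun i => (n i : ℝ)) = mask (digitR D) ζ := by
  unfold mask
  congr 1
  refine Finset.sum_congr rfl fun i _ => ?_
  rw [expChar_sub]
  have : expChar (fun i => (n i : ℝ)) (digitR D i) = 1 := by
    unfold expChar digitR
    rw [Complex.exp_eq_one_iff]
    refine ⟨-(n 0 * D i 0 + n 1 * D i 1), ?_⟩
    push_cast; ring
  rw [this]; simp

theorem core (p : ℕ) (hp : p.Prime) (r₁ r₂ : ℝ) (h1 : 0 < r₁) (h1' : r₁ < 1) (h2 : 0 < r₂)
    (h2' : r₂ < 1) (D : Fin p → (Fin 2 → ℤ)) (a : Fin 2 → ℤ) (hZ : ZeroSetCond p D a)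
    (d t : ℤ) (hd : d ≠ 0) (ht : r₁⁻¹ = (t : ℝ)) (hpt : (p : ℤ) ∣ t) (c' : ℝ)
    (D' : Fin p → (Fin 2 → ℝ))
    (hmask : ∀ η, mask D' η = mask (digitR D) ![η 0 / d, c' * η 0 + η 1])
    (i₀ i₁ : Fin p) (hi : i₁ ≠ i₀) (hi0 : D' i₀ = 0) (hi1 : D' i₁ = ![1, 0])
    (μ : Measure (Fin 2 → ℝ)) [IsProbabilityMeasure μ]
    (href : ∀ ξ, ftMeasure μ ξ = mask D' (scl r₁ r₂ 1 ξ) * ftMeasure μ (scl r₁ r₂ 1 ξ))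
    (Λ : Set (Fin 2 → ℝ))
    (hort : ∀ l ∈ Λ, ∀ l' ∈ Λ, l ≠ l' → ftMeasure μ (l - l') = 0)
    (hpars : ∀ ξ, HasSum (fun l : Λ => ‖ftMeasure μ (ξ - l)‖ ^ 2) 1) :
    ∃ l ∈ Λ, ∀ k : ℕ, (k = 1 ∨ k = 2 ∨ k = 3) →
      ∃ x ∈ Λ, mask D' (scl r₁ r₂ k (x - l)) = 0 := by
  have hp0 : (p:ℝ) ≠ 0 := by exact_mod_cast hp.ne_zero
  have hdR : (d:ℝ) ≠ 0 := by exact_mod_cast hd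
  have htR : (t:ℝ) ≠ 0 := by rw [← ht]; exact inv_ne_zero h1.ne'
  have ht0 : t ≠ 0 := by exact_mod_cast htR
  have hr : r₁ = (t:ℝ)⁻¹ := by rw [← ht, inv_inv]
  have hconv : ∀ (k : ℕ) (δ : ℝ) (q : ℤ), r₁ ^ k * δ / d = q / p → δ * p = (t:ℝ) ^ k * d * q := by
    intro k δ q h
    rw [hr, inv_pow] at h
    field_simp at h
    linear_combination h
  set Z : ℕ → (Fin 2 → ℝ) → Prop := fun k δ => mask D' (scl r₁ r₂ k δ) = 0 with hZdef
  set W : (Fin 2 → ℝ) → (Fin 2 → ℝ) := fun η => ![η 0 / d, c' * η 0 + η 1] with hW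
  have hWsub : ∀ x y, W (scl r₁ r₂ 1 (x - y)) = W (scl r₁ r₂ 1 x) - W (scl r₁ r₂ 1 y) := by
    intro x y; ext i; fin_cases i <;> simp [hW, scl] <;> ring
  have hzero : ∀ k δ, Z k δ ↔ ∃ j : ℕ, 1 ≤ j ∧ j ≤ p - 1 ∧ ∃ n : Fin 2 → ℤ,
      ∀ i, W (scl r₁ r₂ k δ) i = (j : ℝ) * (a i : ℝ) / p + (n i : ℝ) := by
    intro k δ
    rw [hZdef, ← hZ.2, hW]; simp only; rw [hmask]
  have hndvd : ∀ j : ℤ, 1 ≤ |j| → |j| ≤ (p:ℤ) - 1 → ¬ (p:ℤ) ∣ j := by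
    intro j hj hj' hdv
    have := Int.le_of_dvd (by omega) ((dvd_abs _ _).2 hdv)
    omega
  have hlev : ∀ k δ, Z k δ → Lev p t d k (δ 0) := by
    intro k δ h
    obtain ⟨j, hj1, hj2, n, hn⟩ := (hzero k δ).1 h
    refine ⟨j * a 0 + p * n 0, not_dvd_lin p hp _ (hZ.1 0) j (hndvd _ ?_ ?_) _, hconv k _ _ ?_⟩
    · rw [abs_of_nonneg] <;> omega
    · have := hp.pos
      rw [abs_of_nonneg] <;> omega
    · have := hn 0
      simp only [hW, scl, Matrix.cons_val_zero] at this
      rw [this]; push_cast; field_simp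
  have hsymm : ∀ k x y, Z k (x - y) → Z k (y - x) := by
    intro k x y h
    have := mask_neg _ _ h
    rwa [← scl_neg, neg_sub] at this
  have hex : ∀ x ∈ Λ, ∀ y ∈ Λ, x ≠ y → ∃ k, 1 ≤ k ∧ Z k (x - y) := fun x hx y hy hxy =>
    mask_of_ft_zero μ r₁ r₂ h1 h1' h2 h2' D' href _ (hort x hx y hy hxy)
  have hnz : ∀ k x, ¬ Z k (x - x) := by
    intro k x h
    have := hlev _ _ h
    rw [sub_self] at this
    exact lev_ne_zero p t d ht0 hd k this
  have huniq : ∀ k m δ, Z k δ → Z m δ → k = m := fun k m δ hk hm =>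
    lev_unique p t d ht0 hd hpt k m _ (hlev _ _ hk) (hlev _ _ hm)
  have htri : ∀ x ∈ Λ, ∀ y ∈ Λ, ∀ z ∈ Λ, ∀ k l, k < l → Z l (x - y) → Z k (y - z) →
      Z k (x - z) := by
    intro x hx y hy z hz k l hkl hxy hyz
    have h := lev_add p t d hpt k l hkl _ _ (hlev _ _ hyz) (hlev _ _ hxy)
    have e : (y - z) 0 + (x - y) 0 = (x - z) 0 := by simp
    rw [e] at h
    have hne : x ≠ z := by
      rintro rfl
      rw [sub_self] at h
      exact lev_ne_zero p t d ht0 hd k h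
    obtain ⟨m, hm, hZm⟩ := hex x hx z hz hne
    rwa [lev_unique p t d ht0 hd hpt k m _ h (hlev _ _ hZm)]
  have hne : Λ.Nonempty := by
    by_contra hemp
    rw [Set.not_nonempty_iff_eq_empty] at hemp
    subst hemp
    have := (hpars 0).unique (hasSum_empty)
    exact one_ne_zero this
  obtain ⟨l₀, hl₀⟩ := hne
  have hle1 : ∀ η, ‖mask D' η‖ ^ 2 ≤ 1 := fun η =>
    pow_le_one₀ (norm_nonneg _) (norm_mask_le hp.pos D' η)
  have step1 : ∃ l₁ ∈ Λ, ∃ l₂ ∈ Λ, Z 1 (l₁ - l₂) := by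
    by_contra! hno
    have hpr : IsProbabilityMeasure (μ.map (scl r₁ r₂ 1)) :=
      Measure.isProbabilityMeasure_map (continuous_scl r₁ r₂ 1).measurable.aemeasurable
    refine final_contra hp.pos μ r₁ r₂ h1 h1' D' i₀ i₁ hi hi0 hi1 Λ hpars ⟨l₀, hl₀⟩ 1
      (fun ξ l => ‖ftMeasure μ (scl r₁ r₂ 1 (ξ - l))‖ ^ 2) ?_ ?_ ?_
    · intro ξ l
      rw [href, norm_mul, mul_pow]
      exact mul_le_of_le_one_left (sq_nonneg _) (hle1 _)
    · intro ξ B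
      have := bessel (μ.map (scl r₁ r₂ 1)) B (fun l : Λ => (l : Fin 2 → ℝ)) ?_ ξ
      · simpa only [ft_map_scl] using this
      · intro x _ y _ hxy
        obtain ⟨k, hk, hZk⟩ := hex x x.2 y y.2 (fun h => hxy (Subtype.ext h))
        have hk1 : k ≠ 1 := by rintro rfl; exact hno _ x.2 _ y.2 hZk
        obtain ⟨m, rfl⟩ : ∃ m, k = m + 1 + 1 := ⟨k - 2, by omega⟩
        rw [ft_map_scl]
        exact ft_zero_of_mask μ r₁ r₂ D' href m _ (by rw [scl_scl]; exact hZk)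
    · intro ξ
      rw [href, norm_mul, mul_pow]
  obtain ⟨l₁, hl₁, l₂, hl₂, h12⟩ := step1
  by_contra! hcon
  have hall1 : ∀ l ∈ Λ, ∃ x ∈ Λ, Z 1 (x - l) := by
    intro l hl
    by_cases h : l = l₁
    · subst h; exact ⟨l₂, hl₂, hsymm _ _ _ h12⟩
    obtain ⟨k, hk, hZk⟩ := hex l hl l₁ hl₁ h
    by_cases hk1 : k = 1
    · subst hk1; exact ⟨l₁, hl₁, hsymm _ _ _ hZk⟩
    · exact ⟨l₂, hl₂, hsymm _ _ _ (htri l hl l₁ hl₁ l₂ hl₂ 1 k (by omega) hZk h12)⟩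
  have hc : ∀ l ∈ Λ, ∀ x ∈ Λ, ∀ y ∈ Λ, Z 2 (x - l) → Z 3 (y - l) → False := by
    intro l hl x hx y hy hx2 hy3
    obtain ⟨w, hw, hw1⟩ := hall1 l hl
    obtain ⟨k, hk, hkn⟩ := hcon l hl
    rcases hk with rfl | rfl | rfl
    · exact hkn w hw hw1
    · exact hkn x hx hx2
    · exact hkn y hy hy3
  have hcls : ∀ l : Λ, ∃ j : ℕ, j < p ∧ ∃ n : Fin 2 → ℤ,
      ∀ i, W (scl r₁ r₂ 1 (l - l₁)) i = (j : ℝ) * (a i : ℝ) / p + (n i : ℝ) := by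
    rintro ⟨l, hl⟩
    by_cases h : Z 1 (l - l₁)
    · obtain ⟨j, hj1, hj2, n, hn⟩ := (hzero _ _).1 h
      exact ⟨j, by omega, n, hn⟩
    refine ⟨0, hp.pos, ?_⟩
    by_cases hll : l = l₁
    · subst hll
      refine ⟨0, fun i => ?_⟩
      simp only [sub_self, scl_zero_vec]
      fin_cases i <;> simp [hW]
    obtain ⟨m, hm, hZm⟩ := hex l hl l₁ hl₁ hll
    have hm1 : m ≠ 1 := by rintro rfl; exact h hZm
    have h3 := htri l hl l₁ hl₁ l₂ hl₂ 1 m (by omega) hZm h12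
    obtain ⟨j, hj1, hj2, n, hn⟩ := (hzero _ _).1 h3
    obtain ⟨j', hj1', hj2', n', hn'⟩ := (hzero _ _).1 h12
    have hdiff : ∀ i, W (scl r₁ r₂ 1 (l - l₁)) i
        = ((j:ℝ) - j') * (a i : ℝ) / p + ((n i : ℝ) - n' i) := by
      intro i
      have e : l - l₁ = (l - l₂) - (l₁ - l₂) := by abel
      rw [e, hWsub, Pi.sub_apply, hn, hn']; ring
    have hjj : j = j' := by
      by_contra hne
      have hL : Lev p t d 1 ((l - l₁) 0) := by
        refine ⟨((j:ℤ) - j') * a 0 + p * (n 0 - n' 0),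
          not_dvd_lin p hp _ (hZ.1 0) _ (hndvd _ ?_ ?_) _, hconv 1 _ _ ?_⟩
        · have : (j:ℤ) - j' ≠ 0 := by omega
          exact Int.one_le_abs this
        · rw [abs_le]; omega
        · have := hdiff 0
          simp only [hW, scl, Matrix.cons_val_zero] at this
          rw [this]; push_cast; field_simp
      exact hm1 (lev_unique p t d ht0 hd hpt m 1 _ (hlev _ _ hZm) hL)
    subst hjj
    refine ⟨n - n', fun i => ?_⟩
    rw [hdiff]; simp
  choose J hJ N hN using hcls
  have hsame : ∀ l l' : Λ, J l = J l' → ¬ Z 1 ((l : Fin 2 → ℝ) - l') := by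
    intro l l' hjj hz
    obtain ⟨n, hn, e⟩ := hlev _ _ hz
    have e1 := hconv 1 (((l : Fin 2 → ℝ) - l') 0) (p * (N l 0 - N l' 0)) (by
      have e2 : W (scl r₁ r₂ 1 ((l : Fin 2 → ℝ) - l')) 0 = (N l 0 : ℝ) - N l' 0 := by
        have e : (l : Fin 2 → ℝ) - l' = (l - l₁) - (l' - l₁) := by abel
        rw [e, hWsub, Pi.sub_apply, hN, hN, hjj]; ring
      simp only [hW, scl, Matrix.cons_val_zero] at e2
      rw [e2]; push_cast; field_simp)
    rw [e] at e1
    have e3 : t ^ 1 * d * n = t ^ 1 * d * (p * (N l 0 - N l' 0)) := by exact_mod_cast e1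
    have e4 := mul_left_cancel₀ (mul_ne_zero (pow_ne_zero _ ht0) hd) e3
    exact hn (e4 ▸ Dvd.intro _ rfl)
  have hK : ∀ j : ℕ, ∃ k, (k = 2 ∨ k = 3) ∧ ∀ l l' : Λ, J l = j → J l' = j →
      ¬ Z k ((l : Fin 2 → ℝ) - l') := by
    intro j
    by_cases hz2 : ∀ l l' : Λ, J l = j → J l' = j → ¬ Z 2 ((l : Fin 2 → ℝ) - l')
    · exact ⟨2, Or.inl rfl, hz2⟩
    push Not at hz2
    obtain ⟨α, β, hα, hβ, hαβ⟩ := hz2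
    refine ⟨3, Or.inr rfl, fun γ δ hγ hδ hγδ => ?_⟩
    have hγ3 := hsymm _ _ _ hγδ
    by_cases hga : γ = α
    · subst hga
      exact hc γ γ.2 β β.2 δ δ.2 (hsymm _ _ _ hαβ) hγ3
    obtain ⟨m, hm, hZm⟩ := hex γ γ.2 α α.2 (fun h => hga (Subtype.ext h))
    have hm1 : m ≠ 1 := by
      rintro rfl; exact hsame γ α (hγ.trans hα.symm) hZm
    by_cases hm2 : m = 2
    · subst hm2
      exact hc γ γ.2 α α.2 δ δ.2 (hsymm _ _ _ hZm) hγ3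
    · have := htri γ γ.2 α α.2 β β.2 2 m (by omega) hZm hαβ
      exact hc γ γ.2 β β.2 δ δ.2 (hsymm _ _ _ this) hγ3
  choose K hK23 hKn using hK
  have hν := fun j => exists_removed hp.pos μ r₁ r₂ D' href (K j) (hK23 j)
  choose ν hνP hνft hνz using hν
  have hfac : ∀ ξ (l : Λ), ‖ftMeasure μ (ξ - l)‖ ^ 2 = ‖mask D' (scl r₁ r₂ (K (J l)) (ξ - l))‖ ^ 2 *
      (‖mask D' (scl r₁ r₂ 1 (ξ - l))‖ ^ 2 * ‖ftMeasure (ν (J l)) (ξ - l)‖ ^ 2) := by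
    intro ξ l
    rw [hνft (J l), norm_mul, norm_mul]; ring
  refine final_contra hp.pos μ r₁ r₂ h1 h1' D' i₀ i₁ hi hi0 hi1 Λ hpars ⟨l₀, hl₀⟩
      (K (J ⟨l₀, hl₀⟩))
      (fun ξ l => ‖mask D' (scl r₁ r₂ 1 (ξ - l))‖ ^ 2 * ‖ftMeasure (ν (J l)) (ξ - l)‖ ^ 2) ?_ ?_ ?_
  · intro ξ l
    rw [hfac]
    exact mul_le_of_le_one_left (by positivity) (hle1 _)
  · intro ξ B
    set ζ := W (scl r₁ r₂ 1 (ξ - l₁)) with hζ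
    have hm1 : ∀ l : Λ, mask D' (scl r₁ r₂ 1 (ξ - l))
        = mask (digitR D) (ζ - fun i => (J l : ℝ) * a i / p) := by
      intro l
      rw [hmask, ← mask_periodic D (ζ - fun i => (J l : ℝ) * a i / p) (N l)]
      congr 1
      have e : ξ - (l : Fin 2 → ℝ) = (ξ - l₁) - (l - l₁) := by abel
      have e2 : W (scl r₁ r₂ 1 (ξ - l)) = ζ - W (scl r₁ r₂ 1 (l - l₁)) := by
        rw [e, hWsub]
      change W (scl r₁ r₂ 1 (ξ - l)) = _
      rw [e2]
      ext i
      simp only [Pi.sub_apply, hN]; ring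
    rw [← Finset.sum_fiberwise_of_maps_to (s := B) (t := Finset.range p) (g := J)
      (fun l _ => Finset.mem_range.2 (hJ l))]
    refine le_trans (Finset.sum_le_sum fun j _ => ?_) (mask_bessel p hp D a hZ ζ)
    have hb := bessel (ν j) (B.filter fun l => J l = j) (fun l : Λ => (l : Fin 2 → ℝ)) ?_ ξ
    · calc _ = ∑ l ∈ B.filter (fun l => J l = j),
            ‖mask (digitR D) (ζ - fun i => (j : ℝ) * a i / p)‖ ^ 2 *
              ‖ftMeasure (ν j) (ξ - l)‖ ^ 2 := by
            refine Finset.sum_congr rfl fun l hl => ?_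
            rw [hm1, (Finset.mem_filter.1 hl).2]
        _ ≤ _ := by
            rw [← Finset.mul_sum]
            exact mul_le_of_le_one_right (sq_nonneg _) hb
    · intro x hx y hy hxy
      have hxj := (Finset.mem_filter.1 hx).2
      have hyj := (Finset.mem_filter.1 hy).2
      obtain ⟨k, hk, hZk⟩ := hex x x.2 y y.2 (fun h => hxy (Subtype.ext h))
      refine hνz j _ k hk ?_ ?_ hZk
      · rintro rfl; exact hsame x y (hxj.trans hyj.symm) hZk
      · rintro rfl; exact hKn j x y hxj hyj hZk
  · intro ξ
    exact hfac ξ ⟨l₀, hl₀⟩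

/-- Lemma 3.8: if `ρ₁⁻¹ = t₁ ∈ pℤ` and `μ_{M',D'}` is a spectral measure with spectrum `Λ`,
then some `λ ∈ Λ` satisfies `(Λ − λ) ∩ Z_k ≠ ∅` for `k = 1, 2, 3`. -/
theorem stmt12 (p : ℕ) (hp : p.Prime) (ρ₁ ρ₂ c : ℝ)
    (hρ10 : 0 < ρ₁) (hρ11 : ρ₁ < 1) (hρ20 : 0 < ρ₂) (hρ21 : ρ₂ < 1) (hρ : ρ₁ ≠ ρ₂)
    (D : Fin p → (Fin 2 → ℤ)) (hD : Function.Injective D)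
    (a : Fin 2 → ℤ) (hZ : ZeroSetCond p D a)
    (hD0 : D ⟨0, hp.pos⟩ = 0)
    (hD11 : D ⟨1, hp.one_lt⟩ 1 = 0) (hD10 : D ⟨1, hp.one_lt⟩ 0 ≠ 0)
    (t₁ : ℤ) (ht₁ : ρ₁⁻¹ = (t₁ : ℝ)) (hpt₁ : (p : ℤ) ∣ t₁)
    (R M' : Matrix (Fin 2) (Fin 2) ℝ)
    (hR : R = !![1 / (D ⟨1, hp.one_lt⟩ 0 : ℝ),
        c / ((D ⟨1, hp.one_lt⟩ 0 : ℝ) * (ρ₁⁻¹ - ρ₂⁻¹)); 0, 1])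
    (hM' : M' = !![ρ₁⁻¹, 0; 0, ρ₂⁻¹])
    (D' : Fin p → (Fin 2 → ℝ)) (hD' : ∀ i, D' i = R.mulVec (digitR D i))
    (μ' : Measure (Fin 2 → ℝ)) (hμ' : IsSelfAffine μ' M' D')
    (Λ : Set (Fin 2 → ℝ)) (hΛc : Λ.Countable)
    (b : HilbertBasis Λ ℂ (Lp ℂ 2 μ'))
    (hb : ∀ lam : Λ, ⇑(b lam) =ᵐ[μ'] expChar (lam : Fin 2 → ℝ)) :
    ∃ lam ∈ Λ, ∀ k : ℕ, (k = 1 ∨ k = 2 ∨ k = 3) →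
      ∃ x ∈ Λ, ∃ η, mask D' η = 0 ∧ x - lam = (M'ᵀ ^ k).mulVec η := by
  subst hM'
  have hP : IsProbabilityMeasure μ' := hμ'.1
  set d := D ⟨1, hp.one_lt⟩ 0 with hd
  have hdR : (d:ℝ) ≠ 0 := by exact_mod_cast hD10
  set c' := c / ((d : ℝ) * (ρ₁⁻¹ - ρ₂⁻¹)) with hc'
  have hD'0 : ∀ i, D' i 0 = (D i 0 : ℝ) / d + c' * D i 1 := by
    intro i
    rw [hD', hR]; simp [Matrix.mulVec, dotProduct, Fin.sum_univ_two, digitR]; ring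
  have hD'1 : ∀ i, D' i 1 = (D i 1 : ℝ) := by
    intro i
    rw [hD', hR]; simp [Matrix.mulVec, dotProduct, Fin.sum_univ_two, digitR]
  have hcore := core p hp ρ₁ ρ₂ hρ10 hρ11 hρ20 hρ21 D a hZ d t₁ hD10 ht₁ hpt₁ c' D' ?_
    ⟨0, hp.pos⟩ ⟨1, hp.one_lt⟩ (by simp) ?_ ?_ μ'
    (selfaffine_ft μ' ρ₁ ρ₂ hρ10.ne' hρ20.ne' D' hμ') Λ ?_ (parseval μ' Λ b hb)
  · obtain ⟨l, hl, h⟩ := hcore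
    refine ⟨l, hl, fun k hk => ?_⟩
    obtain ⟨x, hx, hm⟩ := h k hk
    refine ⟨x, hx, _, hm, ?_⟩
    have hpow : (!![ρ₁⁻¹, 0; 0, ρ₂⁻¹] : Matrix (Fin 2) (Fin 2) ℝ)ᵀ ^ k
        = !![(ρ₁⁻¹) ^ k, 0; 0, (ρ₂⁻¹) ^ k] := by
      clear hm hk
      induction k with
      | zero => ext i j; fin_cases i <;> fin_cases j <;> simp
      | succ k ih =>
        rw [pow_succ, ih]
        ext i j; fin_cases i <;> fin_cases j <;> simp [pow_succ, Matrix.mul_apply]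
    rw [hpow]
    ext i
    fin_cases i <;> simp [scl, Matrix.mulVec, dotProduct, Fin.sum_univ_two] <;> field_simp
  · intro η
    unfold mask
    congr 1
    refine Finset.sum_congr rfl fun i _ => ?_
    simp only [expChar, hD'0, hD'1, digitR]
    congr 3
    simp; ring
  · ext i
    fin_cases i
    · simp [hD'0, hD0]
    · simp [hD'1, hD0]
  · ext i
    fin_cases i
    · simp only [Fin.zero_eta, hD'0, hD11, ← hd]; simp [hdR]
    · simp [hD'1, hD11]
  · intro x hx y hy hxy
    rw [← inner_exp μ' (b ⟨y, hy⟩) (b ⟨x, hx⟩) y x (hb ⟨y, hy⟩) (hb ⟨x, hx⟩)]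
    exact b.orthonormal.2 (fun h => hxy (congrArg Subtype.val h).symm)

end
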